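/- arXiv:2103.06354 — 3 statements merged into one kernel-verified Lean document; each statement's English description precedes it below -/
import Mathlib

section
/- Let p be a prime, k, r positive integers, G_1, …, G_k finite-dimensional F_p-vector spaces, G⊕ = G_1 ⊕ ⋯ ⊕ G_k, and ξ > 0. Suppose a multilinear form ψ : (G⊕)^{r−1} × G_1 × ⋯ × G_k → F_p and a function f : G⊕ → 𝔻 satisfy condition (★): E_{a^{(1)},…,a^{(r−1)} ∈ G⊕, d_1 ∈ G_1,…,d_k ∈ G_k, x ∈ G⊕} Δ_{a^{(1)}} ⋯ Δ_{a^{(r−1)}} Δ_{d_1} ⋯ Δ_{d_k} f(x) · ω^{ψ(a^{(1)},…,a^{(r−1)},d_1,…,d_k)} ≥ ξ. Then for every pair i < j in [r−1], the multilinear form ψ_{ij} defined by ψ_{ij}(a^{(1)},…,a^{(r−1)},d_1,…,d_k) = ψ(a^{(1)},…,a^{(r−1)},d_1,…,d_k) − ψ(a^{(1)},…,a^{(i−1)},a^{(j)},a^{(i+1)},…,a^{(j−1)},a^{(i)},a^{(j+1)},…,a^{(r−1)},d_1,…,d_k) (i.e. with a^{(i)} and a^{(j)} swapped) satisfies bias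 ψ_{ij} ≥ ξ^8. -/
noncomputable section

namespace DGU

/-- `e^{2πi t/p}` for `t ∈ ℤ/p`. -/
def chi (p : ℕ) (t : ZMod p) : ℂ :=
  Complex.exp (2 * Real.pi * Complex.I * ((t.val : ℂ) / (p : ℂ)))

/-- Average of a complex-valued function over a finite type. -/
def cavg {α : Type*} [Fintype α] (f : α → ℂ) : ℂ :=
  (∑ x, f x) / (Fintype.card α : ℂ)

/-- Average of a real-valued function over a finite type. -/
def ravg {α : Type*} [Fintype α] (f : α → ℝ) : ℝ :=
  (∑ x, f x) / (Fintype.card α : ℝ)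

/-- Multiplicative discrete derivative. -/
def mder {G : Type*} [Add G] (u : G) (f : G → ℂ) : G → ℂ :=
  fun x => f (x + u) * (starRingEnd ℂ) (f x)

/-- Iterated multiplicative discrete derivative along a list of directions. -/
def mderList {G : Type*} [Add G] (l : List G) (f : G → ℂ) : G → ℂ :=
  l.foldr mder f

/-- Additive discrete derivative. -/
def aderiv {G R : Type*} [Add G] [Sub R] (a : G) (F : G → R) : G → R :=
  fun x => F (x + a) - F x

/-- Iterated additive discrete derivative along a list of directions. -/
def aderivList {G R : Type*} [Add G] [Sub R] (l : List G) (F : G → R) : G → R :=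
  l.foldr aderiv F

/-- `t`-fold iterated exponential. -/
def iterExp : ℕ → ℝ → ℝ
  | 0, x => x
  | t + 1, x => Real.exp (iterExp t x)

/-- `P : G → R` is a polynomial of degree at most `d`. -/
def IsPolyDegLE {G R : Type*} [Add G] [Sub R] [Zero R] (d : ℕ) (P : G → R) : Prop :=
  ∀ (a : Fin (d + 1) → G) (x : G), aderivList (List.ofFn a) P x = 0

/-- `n`-fold complex conjugation. -/
def conjIter (n : ℕ) (z : ℂ) : ℂ := (starRingEnd ℂ)^[n] z

/-- Cubical convolution of a family of functions indexed by subsets of `[k]`. -/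
def cubicalConv {k : ℕ} {G : Fin k → Type*} [∀ i, AddCommGroup (G i)] [∀ i, Fintype (G i)]
    (f : Finset (Fin k) → (∀ i, G i) → ℂ) : (∀ i, G i) → ℂ :=
  fun a => cavg (fun x : ∀ i, G i =>
    ∏ I : Finset (Fin k),
      conjIter (k - I.card) (f I (fun i => if i ∈ I then x i + a i else x i)))

/-- A map on a product of `ℤ/p`-vector spaces is multiaffine if it is affine in each
variable separately. -/
def IsMultiaffine (p : ℕ) {k : ℕ} {G : Fin k → Type*} [∀ i, AddCommGroup (G i)]
    [∀ i, Module (ZMod p) (G i)] {W : Type*} [AddCommGroup W] [Module (ZMod p) W]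
    (α : (∀ i, G i) → W) : Prop :=
  ∀ (d : Fin k) (x : ∀ i, G i), ∃ (L : G d →ₗ[ZMod p] W) (c : W),
    ∀ y : G d, α (Function.update x d y) = L y + c

/-- A function `ψ : A^m × G₁ × ⋯ × G_k → ℤ/p` which is linear in each of the `m + k`
variables separately. -/
def MultilinearPair (p m k : ℕ) (A : Type*) [AddCommGroup A] [Module (ZMod p) A]
    (G : Fin k → Type*) [∀ i, AddCommGroup (G i)] [∀ i, Module (ZMod p) (G i)]
    (ψ : (Fin m → A) → (∀ j, G j) → ZMod p) : Prop :=
  (∀ (i : Fin m) (a : Fin m → A) (d : ∀ j, G j) (u v : A) (s t : ZMod p),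
      ψ (Function.update a i (s • u + t • v)) d =
        s * ψ (Function.update a i u) d + t * ψ (Function.update a i v) d) ∧
  (∀ (j : Fin k) (a : Fin m → A) (d : ∀ l, G l) (u v : G j) (s t : ZMod p),
      ψ a (Function.update d j (s • u + t • v)) =
        s * ψ a (Function.update d j u) + t * ψ a (Function.update d j v))

/-- The `2^k`-th power of the Gowers box norm. -/
def boxPow {k : ℕ} {G : Fin k → Type*} [∀ i, Fintype (G i)] (f : (∀ i, G i) → ℂ) : ℂ :=
  cavg (fun z : (∀ i, G i) × (∀ i, G i) =>
    ∏ I : Finset (Fin k), conjIter I.card (f (fun i => if i ∈ I then z.1 i else z.2 i)))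

/-- `μ` belongs to the `ε`-large multilinear spectrum of `f`. -/
def MemMLS (p : ℕ) {k : ℕ} {G : Fin k → Type*} [∀ i, Fintype (G i)] [∀ i, AddCommGroup (G i)]
    [∀ i, Module (ZMod p) (G i)] (ε : ℝ) (f : (∀ i, G i) → ℂ)
    (μ : MultilinearMap (ZMod p) G (ZMod p)) : Prop :=
  ε ^ 2 ^ k ≤ (boxPow (fun x => f x * chi p (μ x))).re


lemma chi_eq_stdAddChar (p : ℕ) [NeZero p] (t : ZMod p) : chi p t = ZMod.stdAddChar t := by
  rw [chi, ZMod.stdAddChar_apply, ZMod.toCircle_apply, mul_div_assoc]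

section MultiplicativeDerivative

variable {A : Type*} [AddCommGroup A]

lemma mder_left_comm (u v : A) (f : A → ℂ) : mder u (mder v f) = mder v (mder u f) := by
  funext x
  simp only [mder, map_mul, add_right_comm x u v]
  ring

lemma mderList_perm {l₁ l₂ : List A} (h : l₁.Perm l₂) (f : A → ℂ) :
    mderList l₁ f = mderList l₂ f := by
  have : LeftCommutative (mder : A → (A → ℂ) → A → ℂ) := ⟨mder_left_comm⟩
  exact h.foldr_eq f

lemma norm_mderList_le_one {f : A → ℂ} (hf : ∀ x, ‖f x‖ ≤ 1) (l : List A) (x : A) :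
    ‖mderList l f x‖ ≤ 1 := by
  induction l generalizing x with
  | nil => exact hf x
  | cons u l ih =>
    change ‖mderList l f (x + u) * (starRingEnd ℂ) (mderList l f x)‖ ≤ 1
    rw [norm_mul, RCLike.norm_conj]
    exact mul_le_one₀ (ih _) (norm_nonneg _) (ih _)

/-- The directions other than the `i`-th and the `j`-th can be differentiated first. -/
lemma exists_mderList_update_update {m : ℕ} {i j : Fin m} (hij : i ≠ j) (c : Fin m → A)
    (D : List A) (f : A → ℂ) :
    ∃ l : List A, ∀ a b : A,
      mderList (List.ofFn (Function.update (Function.update c i a) j b) ++ D) f =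
        mder a (mder b (mderList l f)) := by
  set R := ((List.finRange m).erase i).erase j with hR
  have hperm : (List.finRange m).Perm (i :: j :: R) :=
    (List.perm_cons_erase (List.mem_finRange i)).trans
      ((List.perm_cons_erase
        ((List.mem_erase_of_ne hij.symm).2 (List.mem_finRange j))).cons i)
  have hnd : (i :: j :: R).Nodup := hperm.nodup_iff.1 (List.nodup_finRange m)
  refine ⟨R.map c ++ D, fun a b => ?_⟩
  have hmap : R.map (Function.update (Function.update c i a) j b) = R.map c := by
    refine List.map_congr_left fun t ht => ?_
    have hti : t ≠ i := by rintro rfl; simp_all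
    have htj : t ≠ j := by rintro rfl; simp_all
    rw [Function.update_of_ne htj, Function.update_of_ne hti]
  have h := (hperm.map (Function.update (Function.update c i a) j b)).append_right D
  rw [← List.ofFn_eq_map] at h
  rw [mderList_perm h]
  simp only [List.map_cons, hmap, Function.update_self, Function.update_of_ne hij]
  rfl

end MultiplicativeDerivative

lemma sum_sum_update {ι A : Type*} [Fintype ι] [DecidableEq ι] [Fintype A] (i : ι)
    (F : (ι → A) → ℂ) :
    ∑ c, ∑ a, F (Function.update c i a) = Fintype.card A * ∑ c, F c := by
  have hinv : Function.Involutive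
      (fun z : (ι → A) × A => (Function.update z.1 i z.2, z.1 i)) := by
    rintro ⟨c, a⟩
    simp
  rw [← Fintype.sum_prod_type']
  rw [Fintype.sum_equiv hinv.toPerm (fun z : (ι → A) × A => F (Function.update z.1 i z.2))
    (fun z => F z.1) (fun _ => rfl), Fintype.sum_prod_type]
  simp [Finset.mul_sum]

lemma sum_sum_sum_update_update {ι A : Type*} [Fintype ι] [DecidableEq ι] [Fintype A] (i j : ι)
    (F : (ι → A) → ℂ) :
    ∑ c, ∑ a, ∑ b, F (Function.update (Function.update c i a) j b) =
      (Fintype.card A : ℂ) ^ 2 * ∑ c, F c := by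
  rw [sum_sum_update i (fun c => ∑ b, F (Function.update c j b)), sum_sum_update]
  ring

lemma norm_sum_sq_le {A : Type*} [Fintype A] (v : A → ℂ) :
    ‖∑ y, v y‖ ^ 2 ≤ Fintype.card A * ∑ y, ‖v y‖ ^ 2 :=
  (pow_le_pow_left₀ (norm_nonneg _) (norm_sum_le _ _) 2).trans
    (by simpa using sq_sum_le_card_mul_sum_sq (s := Finset.univ) (f := fun y => ‖v y‖))

section Bilinear

variable {A R : Type*} [AddCommGroup A] [Fintype A] [AddCommGroup R]

/-- Each slice of the bias of a biadditive form is zero or full, hence a nonnegative real. -/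
lemma sum_addChar_eq_norm (e : AddChar R ℂ) (δ : A →+ R) :
    ∑ y, e (δ y) = (‖∑ y, e (δ y)‖ : ℂ) := by
  have h := AddChar.sum_eq_ite (e.compAddMonoidHom δ)
  simp only [AddChar.compAddMonoidHom_apply] at h
  rw [h]
  split_ifs <;> simp

variable [Finite R]

lemma sum_norm_sq_le (e : AddChar R ℂ) (γ : A →+ A →+ R) (u : A → ℂ) (hu : ∀ x, ‖u x‖ ≤ 1) :
    ∑ y, ‖∑ x, u x * e (γ x y)‖ ^ 2 ≤ Fintype.card A * ∑ x, ‖∑ y, e (γ x y)‖ := by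
  have expand : ((∑ y, ‖∑ x, u x * e (γ x y)‖ ^ 2 : ℝ) : ℂ) =
      ∑ x', ∑ x, u x * (starRingEnd ℂ) (u x') * ∑ y, e (γ (x - x') y) := by
    push_cast
    simp_rw [← Complex.mul_conj', map_sum, Finset.sum_mul_sum, Finset.mul_sum]
    rw [Finset.sum_comm, Finset.sum_congr rfl fun x _ => Finset.sum_comm, Finset.sum_comm]
    refine Finset.sum_congr rfl fun x' _ => Finset.sum_congr rfl fun x _ =>
      Finset.sum_congr rfl fun y _ => ?_
    rw [map_sub, AddMonoidHom.sub_apply, sub_eq_add_neg, AddChar.map_add_eq_mul,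
      AddChar.map_neg_eq_conj, map_mul]
    ring
  have hnonneg : 0 ≤ ∑ y, ‖∑ x, u x * e (γ x y)‖ ^ 2 := by positivity
  rw [← abs_of_nonneg hnonneg, ← Real.norm_eq_abs, ← Complex.norm_real, expand]
  calc ‖∑ x', ∑ x, u x * (starRingEnd ℂ) (u x') * ∑ y, e (γ (x - x') y)‖
      ≤ ∑ x', ∑ x, ‖∑ y, e (γ (x - x') y)‖ := by
        refine norm_sum_le_of_le _ fun x' _ => norm_sum_le_of_le _ fun x _ => ?_
        rw [norm_mul, norm_mul, RCLike.norm_conj]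
        exact mul_le_of_le_one_left (norm_nonneg _)
          (mul_le_one₀ (hu _) (norm_nonneg _) (hu _))
    _ = ∑ _x' : A, ∑ x, ‖∑ y, e (γ x y)‖ :=
        Finset.sum_congr rfl fun x' _ =>
          Fintype.sum_equiv (Equiv.subRight x') _ _ fun _ => rfl
    _ = _ := by simp

lemma norm_sum_mul_mul_addChar_sq_le (e : AddChar R ℂ) (γ : A →+ A →+ R) (u v : A → ℂ)
    (hu : ∀ x, ‖u x‖ ≤ 1) (hv : ∀ y, ‖v y‖ ≤ 1) :
    ‖∑ x, ∑ y, u x * v y * e (γ x y)‖ ^ 2 ≤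
      (Fintype.card A : ℝ) ^ 2 * ∑ x, ‖∑ y, e (γ x y)‖ := by
  calc ‖∑ x, ∑ y, u x * v y * e (γ x y)‖ ^ 2
      = ‖∑ y, v y * ∑ x, u x * e (γ x y)‖ ^ 2 := by
        rw [Finset.sum_comm]
        simp_rw [Finset.mul_sum]
        refine congrArg (‖·‖ ^ 2)
          (Finset.sum_congr rfl fun y _ => Finset.sum_congr rfl fun x _ => ?_)
        ring
    _ ≤ Fintype.card A * ∑ y, ‖v y * ∑ x, u x * e (γ x y)‖ ^ 2 := norm_sum_sq_le _
    _ ≤ Fintype.card A * ∑ y, ‖∑ x, u x * e (γ x y)‖ ^ 2 := by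
        gcongr with y
        rw [norm_mul]
        exact mul_le_of_le_one_left (norm_nonneg _) (hv y)
    _ ≤ Fintype.card A * (Fintype.card A * ∑ x, ‖∑ y, e (γ x y)‖) := by
        gcongr
        exact sum_norm_sq_le e γ u hu
    _ = _ := by ring

/-- Substituting `y = x + a`, `s = 2x + a + b` separates the variables `x` and `y` up to the
alternating form `β x y - β y x`. -/
lemma norm_sum_mder_mder_sq_le (e : AddChar R ℂ) (β : A →+ A →+ R) (g : A → ℂ)
    (hg : ∀ x, ‖g x‖ ≤ 1) :
    ‖∑ a, ∑ b, ∑ x, mder a (mder b g) x * e (β a b)‖ ^ 2 ≤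
      (Fintype.card A : ℝ) ^ 4 * (∑ a, ∑ b, e (β a b - β b a)).re := by
  set γ : A →+ A →+ R := β - β.flip
  have hγa (a b : A) : γ a b = β a b - β b a := rfl
  set K : ℝ := ∑ x, ‖∑ y, e (γ x y)‖
  have hre : (∑ a, ∑ b, e (β a b - β b a)).re = K := by
    simp_rw [← hγa]
    rw [Finset.sum_congr rfl fun a _ => sum_addChar_eq_norm e (γ a), ← Complex.ofReal_sum,
      Complex.ofReal_re]
  have hnorm (t : R) : ‖e t‖ ≤ 1 := (AddChar.norm_apply e t).le
  let u (s x : A) : ℂ := g (s - x) * g x * e (β x x - β x s)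
  let v (s y : A) : ℂ :=
    (starRingEnd ℂ) (g y) * (starRingEnd ℂ) (g (s - y)) * e (β y s - β y y)
  have hu (s x : A) : ‖u s x‖ ≤ 1 := by
    simp only [u, norm_mul]
    exact mul_le_one₀ (mul_le_one₀ (hg _) (norm_nonneg _) (hg _)) (norm_nonneg _) (hnorm _)
  have hv (s y : A) : ‖v s y‖ ≤ 1 := by
    simp only [v, norm_mul, RCLike.norm_conj]
    exact mul_le_one₀ (mul_le_one₀ (hg _) (norm_nonneg _) (hg _)) (norm_nonneg _) (hnorm _)
  have hsub : ∑ a, ∑ b, ∑ x, mder a (mder b g) x * e (β a b) =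
      ∑ s, ∑ x, ∑ y, u s x * v s y * e (γ x y) := by
    calc ∑ a, ∑ b, ∑ x, mder a (mder b g) x * e (β a b)
        = ∑ x, ∑ a, ∑ b, mder a (mder b g) x * e (β a b) := by
          rw [Finset.sum_congr rfl fun a _ => Finset.sum_comm, Finset.sum_comm]
      _ = ∑ x, ∑ y, ∑ s, u s x * v s y * e (γ x y) := by
          refine Finset.sum_congr rfl fun x _ => ?_
          refine Fintype.sum_equiv (Equiv.addRight x) _ _ fun a => ?_
          refine Fintype.sum_equiv (Equiv.addRight (x + a + x)) _ _ fun b => ?_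
          have h₁ : b + (x + a + x) - x = x + a + b := by abel
          have h₂ : b + (x + a + x) - (a + x) = x + b := by abel
          have hβ : β a b = (β x x - β x (b + (x + a + x))) +
              (β (a + x) (b + (x + a + x)) - β (a + x) (a + x)) + γ x (a + x) := by
            simp only [hγa, map_add, AddMonoidHom.add_apply]
            abel
          simp only [Equiv.coe_addRight, u, v, mder, map_mul, h₁, h₂, Complex.conj_conj]
          rw [hβ, AddChar.map_add_eq_mul, AddChar.map_add_eq_mul, add_comm a x]
          ring
      _ = _ := by
          rw [Finset.sum_congr rfl fun x _ => Finset.sum_comm, Finset.sum_comm]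
  rw [hre, hsub]
  calc ‖∑ s, ∑ x, ∑ y, u s x * v s y * e (γ x y)‖ ^ 2
      ≤ Fintype.card A * ∑ s, ‖∑ x, ∑ y, u s x * v s y * e (γ x y)‖ ^ 2 := norm_sum_sq_le _
    _ ≤ Fintype.card A * ∑ _s : A, (Fintype.card A : ℝ) ^ 2 * K := by
        gcongr with s
        exact norm_sum_mul_mul_addChar_sq_le e γ (u s) (v s) (hu s) (hv s)
    _ = _ := by
        simp only [Finset.sum_const, Finset.card_univ, nsmul_eq_mul]
        ring

end Bilinear

/-- Proposition 10, Symmetry I: if the phase of a multilinear form `ψ`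
correlates with the iterated derivative of `f` (condition (★)), then for any `i < j` the
form `ψ_{ij}`, obtained by subtracting from `ψ` its version with the `i`-th and `j`-th
`a`-arguments swapped, has bias at least `ξ^8`. -/
theorem symmetry_argument_I
    (p k r : ℕ) (hp : p.Prime) (hk : 0 < k) (hr : 0 < r)
    (G : Fin k → Type) [∀ i, AddCommGroup (G i)] [∀ i, Module (ZMod p) (G i)]
    [∀ i, Fintype (G i)]
    (ψ : (Fin (r - 1) → ∀ i, G i) → (∀ j, G j) → ZMod p)
    (hψ : MultilinearPair p (r - 1) k (∀ i, G i) G ψ)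
    (f : (∀ i, G i) → ℂ) (hf : ∀ x, ‖f x‖ ≤ 1) (ξ : ℝ) (hξ : 0 < ξ)
    (hstar : ξ ≤
      (cavg (fun z : (Fin (r - 1) → ∀ i, G i) × (∀ i, G i) × (∀ i, G i) =>
        mderList (List.ofFn z.1 ++ List.ofFn fun i : Fin k => Pi.single i (z.2.1 i)) f z.2.2 *
          chi p (ψ z.1 z.2.1))).re) :
    ∀ i j : Fin (r - 1), i < j →
      ξ ^ 8 ≤
        (cavg (fun z : (Fin (r - 1) → ∀ i, G i) × (∀ i, G i) =>
          chi p (ψ z.1 z.2 - ψ (z.1 ∘ Equiv.swap i j) z.2))).re := by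
  intro i j hlt
  have hij : i ≠ j := hlt.ne
  have : NeZero p := ⟨hp.ne_zero⟩
  simp only [chi_eq_stdAddChar] at hstar ⊢
  set e : AddChar (ZMod p) ℂ := ZMod.stdAddChar
  have hnorm (t : ZMod p) : ‖e t‖ = 1 := AddChar.norm_apply e t
  set N : ℝ := (Fintype.card (∀ i, G i) : ℝ) with hN
  set M : ℝ := (Fintype.card (Fin (r - 1) → ∀ i, G i) : ℝ) with hM
  have hNpos : 0 < N := by rw [hN]; exact_mod_cast Fintype.card_pos
  have hMpos : 0 < M := by rw [hM]; exact_mod_cast Fintype.card_pos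
  let F (c : Fin (r - 1) → ∀ i, G i) (d x : ∀ i, G i) : ℂ :=
    mderList (List.ofFn c ++ List.ofFn fun i : Fin k => Pi.single i (d i)) f x * e (ψ c d)
  let B (c : Fin (r - 1) → ∀ i, G i) (d : ∀ i, G i) : ℂ :=
    e (ψ c d - ψ (c ∘ Equiv.swap i j) d)
  let upd (c : Fin (r - 1) → ∀ i, G i) (a b : ∀ i, G i) :=
    Function.update (Function.update c i a) j b
  have hswap (c a b) : upd c a b ∘ Equiv.swap i j = upd c b a := by
    funext t
    simp only [upd, Function.comp_apply, Equiv.swap_apply_def, Function.update_apply]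
    split_ifs <;> simp_all
  have hslice (d c) : ‖∑ a, ∑ b, ∑ x, F (upd c a b) d x‖ ^ 2 ≤
      N ^ 4 * (∑ a, ∑ b, B (upd c a b) d).re := by
    obtain ⟨l, hl⟩ := exists_mderList_update_update hij c
      (List.ofFn fun i : Fin k => Pi.single i (d i)) f
    let β : (∀ i, G i) →+ (∀ i, G i) →+ ZMod p := AddMonoidHom.mk'
      (fun a => AddMonoidHom.mk' (fun b => ψ (upd c a b) d) fun b b' => by
        simpa using hψ.1 j (Function.update c i a) d b b' 1 1)
      fun a a' => by
        refine AddMonoidHom.ext fun b => ?_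
        simpa [upd, Function.update_comm hij] using
          hψ.1 i (Function.update c j b) d a a' 1 1
    have h := norm_sum_mder_mder_sq_le e β (mderList l f) (norm_mderList_le_one hf l)
    have hβ (a b) : β a b = ψ (upd c a b) d := rfl
    simpa only [F, B, upd, hl, hβ, hswap] using h
  have hF : ∑ d, ∑ c, ∑ a, ∑ b, ∑ x, F (upd c a b) d x =
      ((N ^ 2 : ℝ) : ℂ) * ∑ d, ∑ c, ∑ x, F c d x := by
    rw [Finset.mul_sum]
    refine Finset.sum_congr rfl fun d _ => ?_
    rw [sum_sum_sum_update_update i j fun c => ∑ x, F c d x]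
    simp [hN]
  have hB : ∑ d, ∑ c, ∑ a, ∑ b, B (upd c a b) d = ((N ^ 2 : ℝ) : ℂ) * ∑ d, ∑ c, B c d := by
    rw [Finset.mul_sum]
    refine Finset.sum_congr rfl fun d _ => ?_
    rw [sum_sum_sum_update_update i j fun c => B c d]
    simp [hN]
  set S := ∑ d, ∑ c, ∑ x, F c d x
  set Q := ∑ d, ∑ c, B c d
  have hmain : ‖S‖ ^ 2 ≤ M * N ^ 3 * Q.re := by
    have h : (N ^ 2 * ‖S‖) ^ 2 ≤ N ^ 4 * (M * N ^ 3 * Q.re) := by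
      calc (N ^ 2 * ‖S‖) ^ 2 = ‖∑ d, ∑ c, ∑ a, ∑ b, ∑ x, F (upd c a b) d x‖ ^ 2 := by
            rw [hF, norm_mul, Complex.norm_real, Real.norm_of_nonneg (by positivity)]
        _ ≤ N * ∑ d, ‖∑ c, ∑ a, ∑ b, ∑ x, F (upd c a b) d x‖ ^ 2 := norm_sum_sq_le _
        _ ≤ N * ∑ d, M * ∑ c, ‖∑ a, ∑ b, ∑ x, F (upd c a b) d x‖ ^ 2 := by
            gcongr with d
            exact norm_sum_sq_le _
        _ ≤ N * ∑ d, M * ∑ c, N ^ 4 * (∑ a, ∑ b, B (upd c a b) d).re := by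
            gcongr with d _ c
            exact hslice d c
        _ = N * M * N ^ 4 * (∑ d, ∑ c, ∑ a, ∑ b, B (upd c a b) d).re := by
            simp only [Complex.re_sum, Finset.mul_sum, mul_assoc]
        _ = N ^ 4 * (M * N ^ 3 * Q.re) := by
            rw [hB, Complex.re_ofReal_mul]
            ring
    have h4 : (0 : ℝ) < N ^ 4 := by positivity
    refine le_of_mul_le_mul_left ?_ h4
    linarith [h]
  have hSle : ‖S‖ ≤ M * N ^ 2 := by
    calc ‖S‖ ≤ ∑ _d : ∀ i, G i, ∑ _c : Fin (r - 1) → ∀ i, G i, ∑ _x : ∀ i, G i, (1 : ℝ) := by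
          refine norm_sum_le_of_le _ fun d _ => norm_sum_le_of_le _ fun c _ =>
            norm_sum_le_of_le _ fun x _ => ?_
          rw [norm_mul, hnorm, mul_one]
          exact norm_mderList_le_one hf _ _
      _ = M * N ^ 2 := by
          simp only [Finset.sum_const, Finset.card_univ, nsmul_eq_mul, mul_one, ← hN, ← hM]
          ring
  have hstar' : ξ * (M * N ^ 2) ≤ ‖S‖ := by
    rw [← le_div_iff₀ (by positivity)]
    refine hstar.trans ((Complex.re_le_norm _).trans_eq ?_)
    have hsum : ∑ z : (Fin (r - 1) → ∀ i, G i) × (∀ i, G i) × (∀ i, G i),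
        F z.1 z.2.1 z.2.2 = S := by
      simp only [Fintype.sum_prod_type]
      exact Finset.sum_comm
    rw [cavg, norm_div, Complex.norm_natCast, Fintype.card_prod, Fintype.card_prod]
    change ‖∑ z : (Fin (r - 1) → ∀ i, G i) × (∀ i, G i) × (∀ i, G i), F z.1 z.2.1 z.2.2‖ / _ = _
    rw [hsum]
    push_cast
    rw [← hN, ← hM]
    ring
  have hξ1 : ξ ≤ 1 := by
    have : ξ * (M * N ^ 2) ≤ 1 * (M * N ^ 2) := by linarith
    exact le_of_mul_le_mul_right this (by positivity)
  have hgoal : (cavg (fun z : (Fin (r - 1) → ∀ i, G i) × (∀ i, G i) =>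
      e (ψ z.1 z.2 - ψ (z.1 ∘ Equiv.swap i j) z.2))).re = Q.re / (M * N) := by
    have hsum : ∑ z : (Fin (r - 1) → ∀ i, G i) × (∀ i, G i), B z.1 z.2 = Q := by
      rw [Fintype.sum_prod_type]
      exact Finset.sum_comm
    change ((∑ z : (Fin (r - 1) → ∀ i, G i) × (∀ i, G i), B z.1 z.2) / _).re = _
    rw [hsum, Complex.div_natCast_re, Fintype.card_prod]
    push_cast
    rw [← hN, ← hM]
  rw [hgoal]
  refine (pow_le_pow_of_le_one hξ.le hξ1 (by norm_num : 2 ≤ 8)).trans ?_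
  rw [le_div_iff₀ (by positivity)]
  have hsq : (ξ * (M * N ^ 2)) ^ 2 ≤ M * N ^ 3 * Q.re :=
    (pow_le_pow_left₀ (by positivity) hstar' 2).trans hmain
  refine le_of_mul_le_mul_left ?_ (by positivity : 0 < M * N ^ 3)
  linarith [hsq]

end DGU
end
end

section
/- Let p be a prime, k, r positive integers with p ≥ r + 1, and let G_j = F_p^{n_j} for j ∈ [k], G⊕ = G_1 ⊕ ⋯ ⊕ G_k, with coordinates x_{j,c} (j ∈ [k], c ∈ [n_j]) on G⊕. Let ψ : (G⊕)^{r−1} × G_1 × ⋯ × G_k → F_p be a multilinear form such that (i) for all i < j in [r−1] the form ψ_{ij} (ψ minus ψ with arguments a^{(i)} and a^{(j)} swapped) is identically zero, and (ii) for all i ∈ [r−1], j ∈ [k] the form ψ'_{ij}(a^{(1)},…,a^{(i−1)}, u_j, a^{(i+1)},…,a^{(r−1)}, d_1,…,d_k) = ψ(…, ι_j(u_j), …, d_1,…,d_j,…,d_k) − ψ(…, ι_j(d_j), …, d_1,…,d_{j−1},u_j,d_{j+1},…,d_k) is identically zero, where ι_j : G_j → G⊕ is the canonical inclusion. Then there exist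 polynomials P ∈ 𝒫_{k,r} and Q (in the coordinates of a^{(1)}, …, a^{(r−1)} and x_1, …, x_k) such that for all a^{(1)}, …, a^{(r−1)} ∈ G⊕ and x_j ∈ G_j, ψ(a^{(1)},…,a^{(r−1)},x_1,…,x_k) = Δ_{a^{(1)}} ⋯ Δ_{a^{(r−1)}} P(x_1,…,x_k) + Q(a^{(1)},…,a^{(r−1)},x_1,…,x_k), where Δ_a F(x) = F(x+a) − F(x) is the additive discrete derivative on G⊕, and for each monomial m appearing in Q there is some i ∈ [k] such that no variable x_{i,c} (c ∈ [n_i]) appears in m. -/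
noncomputable section

namespace DGU

section Translation

open MvPolynomial

variable {σ K : Type*} [CommRing K]

/-- The substitution `x ↦ x + a` on polynomials. -/
def translate (a : σ → K) : MvPolynomial σ K →ₐ[K] MvPolynomial σ K :=
  aeval fun s => X s + C (a s)

/-- The discrete derivative of a polynomial in direction `a`. -/
def polyDiff (a : σ → K) : MvPolynomial σ K →ₗ[K] MvPolynomial σ K :=
  (translate a).toLinearMap - LinearMap.id

/-- The formal derivative of a polynomial in direction `a`. -/
def dirDeriv (a : σ → K) : Derivation K (MvPolynomial σ K) (MvPolynomial σ K) :=
  mkDerivation K fun s => C (a s)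

theorem polyDiff_apply (a : σ → K) (f : MvPolynomial σ K) :
    polyDiff a f = translate a f - f := rfl

theorem eval_translate (a x : σ → K) (f : MvPolynomial σ K) :
    eval x (translate a f) = eval (x + a) f := by
  have h : (aeval x).comp (translate a) = aeval (R := K) (x + a) := by
    ext s
    simp [translate]
  exact DFunLike.congr_fun h f

theorem aderivList_eval_comp {G : Type*} [AddCommGroup G] (φ : G →+ σ → K)
    (f : MvPolynomial σ K) (l : List G) (x : G) :
    aderivList l (fun y => eval (φ y) f) x =
      eval (φ x) ((l.map φ).foldr (fun a g => polyDiff a g) f) := by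
  induction l generalizing x with
  | nil => rfl
  | cons a l ih =>
    change aderivList l (fun y => eval (φ y) f) (x + a) -
      aderivList l (fun y => eval (φ y) f) x = _
    simp [ih, polyDiff_apply, eval_translate]

/-- Polynomials of degree less than `n`. -/
def degLT (σ K : Type*) [CommRing K] (n : ℕ) : Submodule K (MvPolynomial σ K) :=
  restrictSupport K {ν | ν.degree < n}

theorem mem_degLT_iff {n : ℕ} {f : MvPolynomial σ K} :
    f ∈ degLT σ K n ↔ ∀ ν, n ≤ ν.degree → coeff ν f = 0 := by
  simp only [degLT, mem_restrictSupport_iff, Set.subset_def, Finset.mem_coe, mem_support_iff,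
    Set.mem_ofPred_eq]
  exact forall_congr' fun ν => by rw [← not_le, not_imp_not]

theorem degLT_mono {n n' : ℕ} (h : n ≤ n') : degLT σ K n ≤ degLT σ K n' :=
  restrictSupport_mono _ fun _ hν => lt_of_lt_of_le hν h

theorem X_mul_mem_degLT {n : ℕ} {f : MvPolynomial σ K} (hf : f ∈ degLT σ K n) (s : σ) :
    X s * f ∈ degLT σ K (n + 1) := by
  classical
  rw [mem_degLT_iff] at hf ⊢
  intro ν hν
  rw [coeff_X_mul']
  split_ifs with hs
  · refine hf _ ?_
    have h : ν - Finsupp.single s 1 + Finsupp.single s 1 = ν :=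
      tsub_add_cancel_of_le (by simpa [Nat.one_le_iff_ne_zero] using hs)
    have := congrArg Finsupp.degree h
    rw [map_add, Finsupp.degree_single] at this
    omega
  · rfl

theorem map_mem_degLT_of_monomial (L : MvPolynomial σ K →ₗ[K] MvPolynomial σ K) {n n' : ℕ}
    (hL : ∀ ν : σ →₀ ℕ, ν.degree < n → L (monomial ν 1) ∈ degLT σ K n')
    {f : MvPolynomial σ K} (hf : f ∈ degLT σ K n) : L f ∈ degLT σ K n' := by
  have : degLT σ K n ≤ (degLT σ K n').comap L := by
    conv_lhs => rw [degLT, restrictSupport_eq_span]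
    rw [Submodule.span_le]
    rintro _ ⟨ν, hν, rfl⟩
    exact hL ν hν
  exact this hf

theorem monomial_one_induction {M : MvPolynomial σ K → ℕ → Prop} (h0 : M 1 0)
    (hX : ∀ s f d, f ∈ degLT σ K (d + 1) → M f d → M (X s * f) (d + 1)) (ν : σ →₀ ℕ) :
    M (monomial ν 1) ν.degree := by
  classical
  induction h : ν.degree generalizing ν with
  | zero =>
    rw [Finsupp.degree_eq_zero_iff] at h
    subst h
    exact h0
  | succ d ih =>
    obtain ⟨s, hs⟩ : ∃ s, ν s ≠ 0 := by
      by_contra! hcon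
      rw [show ν = 0 from Finsupp.ext hcon] at h
      simp at h
    have hν : Finsupp.single s 1 + (ν - Finsupp.single s 1) = ν :=
      add_tsub_cancel_of_le (by simpa [Nat.one_le_iff_ne_zero] using hs)
    have hd := congrArg Finsupp.degree hν
    rw [map_add, Finsupp.degree_single] at hd
    have hd' : (ν - Finsupp.single s 1).degree = d := by omega
    rw [← hν, show monomial (Finsupp.single s 1 + (ν - Finsupp.single s 1)) (1 : K) =
      X s * monomial (ν - Finsupp.single s 1) 1 by rw [X, monomial_mul, one_mul]]
    refine hX _ _ _ ?_ (ih _ hd')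
    simp [degLT, hd']

theorem translate_X (a : σ → K) (s : σ) : translate a (X s) = X s + C (a s) := by
  simp [translate]

theorem dirDeriv_X (a : σ → K) (s : σ) : dirDeriv a (X s) = C (a s) := by
  simp [dirDeriv]

theorem C_mul_mem_degLT {n : ℕ} {f : MvPolynomial σ K} (hf : f ∈ degLT σ K n) (c : K) :
    C c * f ∈ degLT σ K n := by
  rw [← smul_eq_C_mul]
  exact Submodule.smul_mem _ _ hf

theorem polyDiff_monomial_mem (a : σ → K) (ν : σ →₀ ℕ) :
    polyDiff a (monomial ν 1) ∈ degLT σ K ν.degree := by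
  refine monomial_one_induction (M := fun f d => polyDiff a f ∈ degLT σ K d) ?_ ?_ ν
  · simp [polyDiff_apply]
  · intro s f d hf ih
    have h : polyDiff a (X s * f) =
        X s * polyDiff a f + C (a s) * polyDiff a f + C (a s) * f := by
      simp only [polyDiff_apply, map_mul, translate_X]
      ring
    rw [h]
    exact add_mem (add_mem (X_mul_mem_degLT ih s)
      (C_mul_mem_degLT (degLT_mono d.le_succ ih) _)) (C_mul_mem_degLT hf _)

theorem polyDiff_mem_degLT (a : σ → K) {n : ℕ} {f : MvPolynomial σ K}
    (hf : f ∈ degLT σ K (n + 1)) : polyDiff a f ∈ degLT σ K n :=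
  map_mem_degLT_of_monomial _
    (fun ν hν => degLT_mono (Nat.lt_succ_iff.1 hν) (polyDiff_monomial_mem a ν)) hf

theorem polyDiff_sub_dirDeriv_mem_degLT (a : σ → K) {n : ℕ} {f : MvPolynomial σ K}
    (hf : f ∈ degLT σ K (n + 2)) : polyDiff a f - dirDeriv a f ∈ degLT σ K n := by
  refine map_mem_degLT_of_monomial
    (polyDiff a - (dirDeriv a : MvPolynomial σ K →ₗ[K] MvPolynomial σ K)) (n := n + 2) ?_ hf
  intro ν hν
  refine monomial_one_induction
    (M := fun f d => ∀ n, d < n + 2 → (f ∈ degLT σ K (d + 1)) →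
      polyDiff a f - dirDeriv a f ∈ degLT σ K n) ?_ ?_ ν n hν ?_
  · intro n _ _
    simp [polyDiff_apply]
  · intro s f d hf ih n hn _
    have h : polyDiff a (X s * f) - dirDeriv a (X s * f) =
        X s * (polyDiff a f - dirDeriv a f) + C (a s) * polyDiff a f := by
      simp only [polyDiff_apply, map_mul, translate_X, Derivation.leibniz, dirDeriv_X,
        smul_eq_mul]
      ring
    rw [h]
    have hd := C_mul_mem_degLT (degLT_mono (by omega : d ≤ n) (polyDiff_mem_degLT a hf)) (a s)
    refine add_mem ?_ hd
    cases n with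
    | zero =>
      obtain rfl : d = 0 := by omega
      have hc : f = C (coeff 0 f) := by
        rw [mem_degLT_iff] at hf
        ext ν
        classical
        rw [coeff_C]
        split_ifs with h0
        · rw [h0]
        · refine hf ν ?_
          rw [zero_add, Nat.one_le_iff_ne_zero, Ne, Finsupp.degree_eq_zero_iff]
          exact fun h => h0 h.symm
      rw [hc]
      simp [polyDiff_apply, translate, dirDeriv]
    | succ n => exact X_mul_mem_degLT (ih n (by omega) hf) s
  · simp [degLT]

theorem dirDeriv_mem_degLT (a : σ → K) {n : ℕ} {f : MvPolynomial σ K}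
    (hf : f ∈ degLT σ K (n + 1)) : dirDeriv a f ∈ degLT σ K n := by
  have h := sub_mem (polyDiff_mem_degLT a hf)
    (polyDiff_sub_dirDeriv_mem_degLT a (degLT_mono (Nat.le_succ _) hf))
  rwa [sub_sub_cancel] at h

theorem foldr_dirDeriv_mem_degLT (l : List (σ → K)) {n : ℕ} {f : MvPolynomial σ K}
    (hf : f ∈ degLT σ K (n + l.length)) :
    l.foldr (fun a g => dirDeriv a g) f ∈ degLT σ K n := by
  induction l generalizing n with
  | nil => exact hf
  | cons a l ih =>
    exact dirDeriv_mem_degLT a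
      (ih (by rwa [List.length_cons, add_comm l.length, ← add_assoc] at hf))

theorem foldr_polyDiff_sub_foldr_dirDeriv_mem_degLT (l : List (σ → K)) {n : ℕ}
    {f : MvPolynomial σ K} (hf : f ∈ degLT σ K (n + 1 + l.length)) :
    l.foldr (fun a g => polyDiff a g) f - l.foldr (fun a g => dirDeriv a g) f ∈
      degLT σ K n := by
  induction l generalizing n with
  | nil => simp
  | cons a l ih =>
    have hf' : f ∈ degLT σ K (n + 1 + 1 + l.length) := by
      rwa [List.length_cons, add_comm l.length, ← add_assoc] at hf
    have h := add_mem (polyDiff_mem_degLT a (ih hf'))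
      (polyDiff_sub_dirDeriv_mem_degLT a (foldr_dirDeriv_mem_degLT l hf'))
    rw [map_sub] at h
    simpa using h

theorem coeff_dirDeriv [Fintype σ] (a : σ → K) (f : MvPolynomial σ K) (ν : σ →₀ ℕ) :
    coeff ν (dirDeriv a f) =
      ∑ s, a s * ((ν s + 1) * coeff (ν + Finsupp.single s 1) f) := by
  have h : dirDeriv a f = ∑ s, C (a s) * pderiv s f := by
    classical
    have : dirDeriv a = ∑ s, (C (a s) : MvPolynomial σ K) • pderiv (R := K) s := by
      refine derivation_ext fun t => ?_
      rw [dirDeriv_X, ← Derivation.coeFnAddMonoidHom_apply, map_sum, Finset.sum_apply]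
      simp [pderiv_X, Pi.single_apply]
    rw [this, ← Derivation.coeFnAddMonoidHom_apply, map_sum, Finset.sum_apply]
    simp
  rw [h, coeff_sum]
  refine Finset.sum_congr rfl fun s _ => ?_
  rw [coeff_C_mul, coeff_pderiv]
  ring

/-- The coefficient of `f` at the divided power monomial with exponent `ν`. -/
def divCoeff [Fintype σ] (f : MvPolynomial σ K) (ν : σ →₀ ℕ) : K :=
  ((∏ s, (ν s).factorial : ℕ) : K) * coeff ν f

theorem prod_factorial_add_single [Fintype σ] (ν : σ →₀ ℕ) (s : σ) :
    ∏ t, ((ν + Finsupp.single s 1 : σ →₀ ℕ) t).factorial =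
      (ν s + 1) * ∏ t, (ν t).factorial := by
  classical
  rw [← Finset.mul_prod_erase _ _ (Finset.mem_univ s),
    ← Finset.mul_prod_erase Finset.univ (fun t => (ν t).factorial) (Finset.mem_univ s), ← mul_assoc]
  congr 1
  · simp [Nat.factorial_succ]
  · refine Finset.prod_congr rfl fun t ht => ?_
    simp [(Finset.ne_of_mem_erase ht).symm]

theorem divCoeff_dirDeriv [Fintype σ] (a : σ → K) (f : MvPolynomial σ K) (ν : σ →₀ ℕ) :
    divCoeff (dirDeriv a f) ν = ∑ s, a s * divCoeff f (ν + Finsupp.single s 1) := by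
  simp only [divCoeff, coeff_dirDeriv, prod_factorial_add_single, Finset.mul_sum]
  refine Finset.sum_congr rfl fun s _ => ?_
  push_cast
  ring

theorem divCoeff_foldr_dirDeriv [Fintype σ] {m : ℕ} (a : Fin m → σ → K)
    (f : MvPolynomial σ K) (ν : σ →₀ ℕ) :
    divCoeff ((List.ofFn a).foldr (fun a g => dirDeriv a g) f) ν =
      ∑ e : Fin m → σ, (∏ i, a i (e i)) *
        divCoeff f (∑ i, Finsupp.single (e i) 1 + ν) := by
  induction m generalizing ν with
  | zero => simp
  | succ m ih =>
    rw [List.ofFn_succ, List.foldr_cons, divCoeff_dirDeriv,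
      ← (Fin.consEquiv fun _ => σ).sum_comp, Fintype.sum_prod_type]
    refine Finset.sum_congr rfl fun s _ => ?_
    rw [ih, Finset.mul_sum]
    refine Finset.sum_congr rfl fun e _ => ?_
    simp only [Fin.consEquiv_apply, Fin.prod_univ_succ, Fin.sum_univ_succ, Fin.cons_zero,
      Fin.cons_succ]
    rw [mul_assoc, add_comm ν, ← add_assoc, add_comm (Finsupp.single s 1)]

end Translation

section Glue

open MvPolynomial

theorem exists_polynomial_of_family {K ι σ : Type*} [Field K] [Fintype K] [Fintype ι]
    (h : (ι → K) → MvPolynomial σ K) (S : Set (σ →₀ ℕ))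
    (hS : ∀ a, ∀ ν ∈ (h a).support, ν ∈ S) :
    ∃ Q : MvPolynomial (ι ⊕ σ) K,
      (∀ M ∈ Q.support, ∃ ν ∈ S, ∀ s, M (Sum.inr s) = ν s) ∧
      ∀ a x, eval (Sum.elim a x) Q = eval x (h a) := by
  classical
  refine ⟨∑ a, rename Sum.inl (indicator a) * rename Sum.inr (h a), ?_, ?_⟩
  · intro M hM
    obtain ⟨a, -, ha⟩ := Finset.mem_biUnion.1 (support_sum hM)
    obtain ⟨M₁, h₁, M₂, h₂, rfl⟩ := Finset.mem_add.1 (support_mul _ _ ha)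
    rw [support_rename_of_injective Sum.inl_injective] at h₁
    rw [support_rename_of_injective Sum.inr_injective] at h₂
    obtain ⟨ν₁, -, rfl⟩ := Finset.mem_image.1 h₁
    obtain ⟨ν₂, hν₂, rfl⟩ := Finset.mem_image.1 h₂
    refine ⟨ν₂, hS a _ hν₂, fun s => ?_⟩
    rw [Finsupp.add_apply, Finsupp.mapDomain_of_notMem_range _ _ (by simp), zero_add,
      Finsupp.mapDomain_apply Sum.inr_injective]
  · intro a x
    rw [map_sum, Finset.sum_eq_single a]
    · simp [eval_rename, eval_indicator_apply_eq_one]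
    · intro b _ hb
      simp [eval_rename, eval_indicator_apply_eq_zero a b hb.symm]
    · simp

end Glue

section Exponents

open MvPolynomial Function

variable {J : Type*} {ι : J → Type*} {m : ℕ} {K : Type*} [Fintype J]

/-- The exponent of the product of one variable from each block. -/
def transExp (v : ∀ j, ι j) : (Σ j, ι j) →₀ ℕ :=
  ∑ j, Finsupp.single ⟨j, v j⟩ 1

/-- The exponent of the product of `m` arbitrary variables and one variable from each block. -/
def fullExp (e : Fin m → Σ j, ι j) (v : ∀ j, ι j) : (Σ j, ι j) →₀ ℕ :=
  ∑ i, Finsupp.single (e i) 1 + transExp v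

theorem transExp_apply [∀ j, DecidableEq (ι j)] (v : ∀ j, ι j) (j : J) (c : ι j) :
    transExp v ⟨j, c⟩ = if v j = c then 1 else 0 := by
  classical
  rw [transExp, Finsupp.finsetSum_apply, Finset.sum_eq_single j]
  · simp [Finsupp.single_apply]
  · intro i _ hij
    rw [Finsupp.single_apply, if_neg]
    exact fun h => hij (congrArg Sigma.fst h)
  · simp

theorem degree_transExp (v : ∀ j, ι j) : (transExp v).degree = Fintype.card J := by
  simp [transExp]

theorem degree_fullExp (e : Fin m → Σ j, ι j) (v : ∀ j, ι j) :
    (fullExp e v).degree = m + Fintype.card J := by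
  simp [fullExp, degree_transExp]

theorem transExp_injective : Injective (transExp : (∀ j, ι j) → _) := by
  classical
  intro v w h
  funext j
  have := DFunLike.congr_fun h ⟨j, v j⟩
  simp only [transExp_apply, if_true] at this
  by_contra hne
  rw [if_neg (Ne.symm hne)] at this
  exact one_ne_zero this

theorem fullExp_apply_le (e : Fin m → Σ j, ι j) (v : ∀ j, ι j) (s : Σ j, ι j) :
    fullExp e v s ≤ m + 1 := by
  classical
  obtain ⟨j, c⟩ := s
  rw [fullExp, Finsupp.add_apply, Finsupp.finsetSum_apply, transExp_apply]
  refine add_le_add ?_ (by split_ifs <;> simp)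
  refine (Finset.sum_le_card_nsmul _ _ 1 fun i _ => ?_).trans (by simp)
  rw [Finsupp.single_apply]
  split_ifs <;> simp

theorem exists_eq_transExp_add (ν : (Σ j, ι j) →₀ ℕ) (h : ∀ j, ∃ c, ν ⟨j, c⟩ ≠ 0) :
    ∃ v κ, ν = transExp v + κ := by
  classical
  choose v hv using h
  refine ⟨v, ν - transExp v, (add_tsub_cancel_of_le fun s => ?_).symm⟩
  obtain ⟨j, c⟩ := s
  rw [transExp_apply]
  split_ifs with hc
  · subst hc
    exact Nat.one_le_iff_ne_zero.2 (hv j)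
  · exact Nat.zero_le _

theorem fullExp_swap [DecidableEq J] (e : Fin m → Σ j, ι j) (v : ∀ j, ι j) (i : Fin m) (j : J)
    (u : ι j) :
    fullExp (update e i ⟨j, u⟩) v = fullExp (update e i ⟨j, v j⟩) (update v j u) := by
  have h₁ : ∀ s, ∑ l, Finsupp.single (update e i s l) 1 =
      Finsupp.single s 1 + ∑ l ∈ Finset.univ.erase i, Finsupp.single (e l) 1 := by
    intro s
    rw [← Finset.add_sum_erase _ _ (Finset.mem_univ i), update_self]
    congr 1
    refine Finset.sum_congr rfl fun l hl => ?_
    rw [update_of_ne (Finset.ne_of_mem_erase hl)]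
  have h₂ : ∀ w : ∀ j, ι j, transExp w = Finsupp.single ⟨j, w j⟩ 1 +
      ∑ l ∈ Finset.univ.erase j, Finsupp.single ⟨l, w l⟩ 1 := by
    intro w
    rw [transExp, ← Finset.add_sum_erase _ _ (Finset.mem_univ j)]
  rw [fullExp, fullExp, h₁, h₁, h₂ v, h₂ (update v j u), update_self]
  have h₃ : ∑ l ∈ Finset.univ.erase j,
      (Finsupp.single (⟨l, update v j u l⟩ : Σ j, ι j) 1 : (Σ j, ι j) →₀ ℕ) =
      ∑ l ∈ Finset.univ.erase j, Finsupp.single ⟨l, v l⟩ 1 := by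
    refine Finset.sum_congr rfl fun l hl => ?_
    rw [update_of_ne (Finset.ne_of_mem_erase hl)]
  rw [h₃]
  abel

theorem exists_perm_of_sum_single_eq {σ : Type*} {e e' : Fin m → σ}
    (h : ∑ i, (Finsupp.single (e i) 1 : σ →₀ ℕ) = ∑ i, Finsupp.single (e' i) 1) :
    ∃ π : Equiv.Perm (Fin m), e = e' ∘ π := by
  classical
  have hcard : ∀ s, Fintype.card {i // e i = s} = Fintype.card {i // e' i = s} := by
    intro s
    have := DFunLike.congr_fun h s
    simpa [Finsupp.finsetSum_apply, Finsupp.single_apply, Fintype.card_subtype] using this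
  refine ⟨(Equiv.sigmaFiberEquiv e).symm.trans
    ((Equiv.sigmaCongrRight fun s => Fintype.equivOfCardEq (hcard s)).trans
      (Equiv.sigmaFiberEquiv e')), funext fun i => ?_⟩
  exact (Fintype.equivOfCardEq (hcard (e i)) ⟨i, rfl⟩).2.symm

theorem comp_perm_eq_of_swap {α β : Type*} (c : (Fin m → α) → β)
    (h : ∀ i j, i < j → ∀ e, c e = c (e ∘ Equiv.swap i j)) (π : Equiv.Perm (Fin m))
    (e : Fin m → α) : c (e ∘ π) = c e := by
  induction π using Equiv.Perm.swap_induction_on generalizing e with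
  | one => rfl
  | swap_mul π i j hij ih =>
    rw [Equiv.Perm.coe_mul, ← comp_assoc, ih]
    rcases lt_or_gt_of_ne hij with hlt | hlt
    · exact (h i j hlt e).symm
    · rw [Equiv.swap_comm]
      exact (h j i hlt e).symm

theorem eq_of_fullExp_eq [DecidableEq J] {β : Type*} (c : (Fin m → Σ j, ι j) → (∀ j, ι j) → β)
    (h₁ : ∀ i j, i < j → ∀ e v, c e v = c (e ∘ Equiv.swap i j) v)
    (h₂ : ∀ i j e u v, c (update e i ⟨j, u⟩) v = c (update e i ⟨j, v j⟩) (update v j u))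
    {e e' : Fin m → Σ j, ι j} {v v' : ∀ j, ι j} (h : fullExp e v = fullExp e' v') :
    c e v = c e' v' := by
  classical
  induction hd : (Finset.univ.filter fun j => v j ≠ v' j).card using Nat.strong_induction_on
    generalizing e v with
  | _ d ih =>
  by_cases hv : v = v'
  · subst hv
    obtain ⟨π, rfl⟩ := exists_perm_of_sum_single_eq (add_right_cancel h)
    exact comp_perm_eq_of_swap (fun e => c e v) (fun i j hij e => h₁ i j hij e v) π e'
  · obtain ⟨j, hj⟩ := Function.ne_iff.1 hv
    obtain ⟨i, hi⟩ : ∃ i, e i = ⟨j, v' j⟩ := by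
      by_contra! hcon
      have := DFunLike.congr_fun h ⟨j, v' j⟩
      simp [fullExp, transExp_apply, Finsupp.single_apply, hcon, hj] at this
    have he : update e i ⟨j, v' j⟩ = e := by rw [← hi, update_eq_self]
    have hc := h₂ i j e (v' j) v
    have hx := fullExp_swap e v i j (v' j)
    rw [he] at hc hx
    rw [hc]
    refine ih _ ?_ (hx.symm.trans h) rfl
    rw [← hd]
    refine Finset.card_lt_card (Finset.ssubset_iff_of_subset ?_ |>.2 ⟨j, by simpa using hj, ?_⟩)
    · intro l hl
      rcases eq_or_ne l j with rfl | hlj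
      · simp at hl
      · simpa [hlj] using hl
    · simp

theorem exists_polynomial_divCoeff [DecidableEq J] [Field K] [∀ j, Fintype (ι j)]
    (hK : ((m + 1).factorial : K) ≠ 0)
    (c : (Fin m → Σ j, ι j) → (∀ j, ι j) → K)
    (hc : ∀ e e' v v', fullExp e v = fullExp e' v' → c e v = c e' v') :
    ∃ P : MvPolynomial (Σ j, ι j) K,
      (∀ ν ∈ P.support, ∃ e : Fin m → Σ j, ι j, ∃ v, fullExp e v = ν) ∧
      ∀ e v, divCoeff P (fullExp e v) = c e v := by
  classical
  set E : (Fin m → Σ j, ι j) × (∀ j, ι j) → (Σ j, ι j) →₀ ℕ := fun q => fullExp q.1 q.2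
  set w : ((Σ j, ι j) →₀ ℕ) → K := extend E (fun q => c q.1 q.2) 0
  have hcoeff : ∀ ν, coeff ν (∑ μ ∈ Finset.univ.image E,
      monomial μ (((∏ s, (μ s).factorial : ℕ) : K)⁻¹ * w μ)) =
      if ν ∈ Finset.univ.image E then ((∏ s, (ν s).factorial : ℕ) : K)⁻¹ * w ν else 0 := by
    intro ν
    simp only [coeff_sum, coeff_monomial, Finset.sum_ite_eq']
  refine ⟨∑ μ ∈ Finset.univ.image E, monomial μ (((∏ s, (μ s).factorial : ℕ) : K)⁻¹ * w μ),
    ?_, ?_⟩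
  · intro ν hν
    rw [mem_support_iff, hcoeff] at hν
    obtain ⟨q, -, hq⟩ := Finset.mem_image.1 (ite_ne_right_iff.1 hν).1
    exact ⟨q.1, q.2, hq⟩
  · intro e v
    have hw : w (fullExp e v) = c e v :=
      FactorsThrough.extend_apply (f := E) (g := fun q => c q.1 q.2)
        (fun q q' h => hc _ _ _ _ h) 0 (e, v)
    rw [divCoeff, hcoeff, if_pos (Finset.mem_image.2 ⟨(e, v), Finset.mem_univ _, rfl⟩), hw,
      mul_inv_cancel_left₀]
    rw [Nat.cast_prod, Finset.prod_ne_zero_iff]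
    intro s _ h0
    refine hK ?_
    obtain ⟨t, ht⟩ := Nat.factorial_dvd_factorial (fullExp_apply_le e v s)
    rw [ht, Nat.cast_mul, h0, zero_mul]

theorem coeff_sub_foldr_polyDiff_eq_zero [DecidableEq J] [Field K] [∀ j, Fintype (ι j)]
    (c : (Fin m → Σ j, ι j) → (∀ j, ι j) → K) (P : MvPolynomial (Σ j, ι j) K)
    (hP : ∀ ν ∈ P.support, ∃ e : Fin m → Σ j, ι j, ∃ v, fullExp e v = ν)
    (hPc : ∀ e v, divCoeff P (fullExp e v) = c e v)
    (a : Fin m → (Σ j, ι j) → K) (ν : (Σ j, ι j) →₀ ℕ) (hν : ∀ j, ∃ c, ν ⟨j, c⟩ ≠ 0) :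
    coeff ν ((∑ v : ∀ j, ι j,
        monomial (transExp v) (∑ e : Fin m → Σ j, ι j, (∏ i, a i (e i)) * c e v)) -
      (List.ofFn a).foldr (fun a g => polyDiff a g) P) = 0 := by
  classical
  have hdeg : P ∈ degLT (Σ j, ι j) K (Fintype.card J + 1 + (List.ofFn a).length) := by
    intro μ hμ
    obtain ⟨e, v, rfl⟩ := hP μ hμ
    simp only [List.length_ofFn, Set.mem_ofPred_eq, degree_fullExp]
    omega
  obtain ⟨v, κ, rfl⟩ := exists_eq_transExp_add ν hν
  have h₁ := mem_degLT_iff.1 (foldr_polyDiff_sub_foldr_dirDeriv_mem_degLT _ hdeg)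
    (transExp v + κ) (by simp [degree_transExp])
  rw [coeff_sub, sub_eq_zero] at h₁
  rw [coeff_sub, h₁, sub_eq_zero, coeff_sum]
  simp only [coeff_monomial]
  by_cases hκ : κ = 0
  · subst hκ
    simp only [add_zero, transExp_injective.eq_iff, Finset.sum_ite_eq', Finset.mem_univ, if_true]
    have h₂ := divCoeff_foldr_dirDeriv a P (transExp v)
    have h₃ : ∏ s, (transExp v s).factorial = 1 := by
      refine Finset.prod_eq_one fun s _ => ?_
      obtain ⟨j, c⟩ := s
      rw [transExp_apply]
      split_ifs <;> rfl
    rw [divCoeff, h₃, Nat.cast_one, one_mul] at h₂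
    rw [h₂]
    exact Finset.sum_congr rfl fun e _ => by rw [← hPc]; rfl
  · have hκ' : κ.degree ≠ 0 := fun h => hκ (Finsupp.degree_eq_zero_iff _ |>.1 h)
    rw [mem_degLT_iff.1 (foldr_dirDeriv_mem_degLT _ hdeg) _
      (by rw [map_add, degree_transExp]; omega)]
    refine Finset.sum_eq_zero fun w _ => if_neg fun h => hκ' ?_
    have := congrArg Finsupp.degree h
    rw [map_add, degree_transExp, degree_transExp] at this
    omega

end Exponents

section Expansion

open Function

variable {p m k : ℕ} {n : Fin k → ℕ}

/-- The standard basis vector with index `s` of a direct sum of coordinate spaces. -/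
def sigmaBasis (p : ℕ) (n : Fin k → ℕ) (s : Σ j : Fin k, Fin (n j)) :
    ∀ j : Fin k, Fin (n j) → ZMod p :=
  Pi.single s.1 (Pi.single s.2 1)

theorem eq_sum_smul_sigmaBasis (x : ∀ j : Fin k, Fin (n j) → ZMod p) :
    x = ∑ s : Σ j : Fin k, Fin (n j), x s.1 s.2 • sigmaBasis p n s := by
  rw [Fintype.sum_sigma]
  conv_lhs => rw [← Finset.univ_sum_single x]
  refine Finset.sum_congr rfl fun j _ => ?_
  conv_lhs => rw [pi_eq_sum_univ' (x j)]
  rw [← LinearMap.coe_single (ZMod p), map_sum]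
  refine Finset.sum_congr rfl fun c _ => ?_
  rw [map_smul]
  congr 2

theorem MultilinearPair.expand
    {ψ : (Fin m → ∀ j : Fin k, Fin (n j) → ZMod p) → (∀ j : Fin k, Fin (n j) → ZMod p) → ZMod p}
    (hψ : MultilinearPair p m k (∀ j : Fin k, Fin (n j) → ZMod p)
      (fun j => Fin (n j) → ZMod p) ψ)
    (a : Fin m → ∀ j : Fin k, Fin (n j) → ZMod p) (x : ∀ j : Fin k, Fin (n j) → ZMod p) :
    ψ a x = ∑ v : ∀ j : Fin k, Fin (n j), (∏ j, x j (v j)) *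
      ∑ e : Fin m → Σ j : Fin k, Fin (n j), (∏ i, a i (e i).1 (e i).2) *
        ψ (fun i => sigmaBasis p n (e i)) (fun j => Pi.single (v j) 1) := by
  let L (d : ∀ j : Fin k, Fin (n j) → ZMod p) : MultilinearMap (ZMod p)
      (fun _ : Fin m => ∀ j : Fin k, Fin (n j) → ZMod p) (ZMod p) :=
    MultilinearMap.mk' (fun a => ψ a d)
      (fun a i u v => by simpa using hψ.1 i a d u v 1 1)
      (fun a i s u => by simpa using hψ.1 i a d u 0 s 0)
  let R : MultilinearMap (ZMod p) (fun j : Fin k => Fin (n j) → ZMod p) (ZMod p) :=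
    MultilinearMap.mk' (fun d => ψ a d)
      (fun d j u v => by simpa using hψ.2 j a d u v 1 1)
      (fun d j s u => by simpa using hψ.2 j a d u 0 s 0)
  have hR : R x = ∑ v : ∀ j : Fin k, Fin (n j), (∏ j, x j (v j)) *
      R (fun j => Pi.single (v j) 1) := by
    have hx : x = fun j => ∑ c, x j c • (Pi.single c 1 : Fin (n j) → ZMod p) := by
      funext j
      ext c
      simp [Finset.sum_apply, Pi.single_apply]
    conv_lhs => rw [hx]
    rw [MultilinearMap.map_sum]
    refine Finset.sum_congr rfl fun v _ => ?_
    rw [MultilinearMap.map_smul_univ, smul_eq_mul]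
  have hL : ∀ d, L d a = ∑ e : Fin m → Σ j : Fin k, Fin (n j),
      (∏ i, a i (e i).1 (e i).2) * L d (fun i => sigmaBasis p n (e i)) := by
    intro d
    have ha : a = fun i => ∑ s : Σ j : Fin k, Fin (n j), a i s.1 s.2 • sigmaBasis p n s :=
      funext fun i => eq_sum_smul_sigmaBasis (a i)
    conv_lhs => rw [ha]
    rw [MultilinearMap.map_sum]
    refine Finset.sum_congr rfl fun v _ => ?_
    rw [MultilinearMap.map_smul_univ, smul_eq_mul]
  refine hR.trans (Finset.sum_congr rfl fun v _ => ?_)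
  congr 1
  exact hL _

end Expansion

/-- Proposition 13, partially symmetric multilinear forms: if `p ≥ r + 1`
and a multilinear form `ψ` on `(G⊕)^{r-1} × G₁ × ⋯ × G_k` (with `G_j = F_p^{n_j}`) has all
its associated forms `ψ_{ij}` and `ψ'_{ij}` identically zero, then `ψ` is the iterated
additive derivative of a polynomial `P ∈ 𝒫_{k,r}` plus a polynomial `Q` each of whose
monomials omits all the variables `x_{i,c}` for some coordinate `i ∈ [k]`. -/
theorem exactly_symmetric_forms_are_derivatives
    (p k r : ℕ) (hp : p.Prime) (hk : 0 < k) (hr : 0 < r) (hpr : r + 1 ≤ p)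
    (n : Fin k → ℕ)
    (ψ : (Fin (r - 1) → ∀ j : Fin k, Fin (n j) → ZMod p) →
      (∀ j : Fin k, Fin (n j) → ZMod p) → ZMod p)
    (hψ : MultilinearPair p (r - 1) k (∀ j : Fin k, Fin (n j) → ZMod p)
      (fun j => Fin (n j) → ZMod p) ψ)
    (hsym1 : ∀ i j : Fin (r - 1), i < j →
      ∀ (a : Fin (r - 1) → ∀ j : Fin k, Fin (n j) → ZMod p)
        (d : ∀ j : Fin k, Fin (n j) → ZMod p),
        ψ a d = ψ (a ∘ Equiv.swap i j) d)
    (hsym2 : ∀ (i : Fin (r - 1)) (j : Fin k)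
      (a : Fin (r - 1) → ∀ l : Fin k, Fin (n l) → ZMod p)
      (u : Fin (n j) → ZMod p) (d : ∀ l : Fin k, Fin (n l) → ZMod p),
        ψ (Function.update a i (Pi.single j u)) d =
          ψ (Function.update a i (Pi.single j (d j))) (Function.update d j u)) :
    ∃ (P : MvPolynomial (Σ j : Fin k, Fin (n j)) (ZMod p))
      (Q : MvPolynomial ((Fin (r - 1) × Σ j : Fin k, Fin (n j)) ⊕ (Σ j : Fin k, Fin (n j)))
        (ZMod p)),
      P.totalDegree ≤ k + r - 1 ∧
      (∀ m ∈ P.support, ∀ i : Fin k, ∃ c : Fin (n i), m ⟨i, c⟩ ≠ 0) ∧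
      (∀ m ∈ Q.support, ∃ i : Fin k, ∀ c : Fin (n i), m (Sum.inr ⟨i, c⟩) = 0) ∧
      ∀ (a : Fin (r - 1) → ∀ j : Fin k, Fin (n j) → ZMod p)
        (x : ∀ j : Fin k, Fin (n j) → ZMod p),
        ψ a x =
          aderivList (List.ofFn a)
            (fun y => MvPolynomial.eval (fun v : Σ j : Fin k, Fin (n j) => y v.1 v.2) P) x +
          MvPolynomial.eval
            (Sum.elim (fun w : Fin (r - 1) × Σ j : Fin k, Fin (n j) => a w.1 w.2.1 w.2.2)
              (fun v : Σ j : Fin k, Fin (n j) => x v.1 v.2)) Q := by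
  classical
  have : Fact p.Prime := ⟨hp⟩
  set c : (Fin (r - 1) → Σ j : Fin k, Fin (n j)) → (∀ j : Fin k, Fin (n j)) → ZMod p :=
    fun e v => ψ (fun i => sigmaBasis p n (e i)) (fun j => Pi.single (v j) 1) with hc
  have hswap : ∀ i j, i < j → ∀ e v, c e v = c (e ∘ Equiv.swap i j) v :=
    fun i j hij e v => hsym1 i j hij _ _
  have hexch : ∀ i j e u v, c (Function.update e i ⟨j, u⟩) v =
      c (Function.update e i ⟨j, v j⟩) (Function.update v j u) := by
    intro i j e u v
    have h₁ : ∀ s, (fun l => sigmaBasis p n (Function.update e i s l)) =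
        Function.update (fun l => sigmaBasis p n (e l)) i (sigmaBasis p n s) := by
      intro s
      exact Function.comp_update (sigmaBasis p n) e i s
    have h₂ : (fun l => (Pi.single (Function.update v j u l) 1 : Fin (n l) → ZMod p)) =
        Function.update (fun l => Pi.single (v l) 1) j (Pi.single u 1) := by
      funext l
      rcases eq_or_ne l j with rfl | hl
      · simp
      · simp [hl]
    simp only [hc, h₁, h₂]
    exact hsym2 i j _ _ _
  have hfact : ((r - 1 + 1).factorial : ZMod p) ≠ 0 := by
    rw [Ne, ZMod.natCast_eq_zero_iff, hp.dvd_factorial]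
    omega
  obtain ⟨P, hP, hPc⟩ := exists_polynomial_divCoeff hfact c
    fun e e' v v' h => eq_of_fullExp_eq c hswap hexch h
  obtain ⟨Q, hQ, hQe⟩ := exists_polynomial_of_family
    (fun b : Fin (r - 1) × (Σ j : Fin k, Fin (n j)) → ZMod p =>
      (∑ v : ∀ j : Fin k, Fin (n j), MvPolynomial.monomial (transExp v)
        (∑ e : Fin (r - 1) → Σ j : Fin k, Fin (n j), (∏ i, b (i, e i)) * c e v)) -
      (List.ofFn fun i s => b (i, s)).foldr (fun a g => polyDiff a g) P)
    {ν | ∃ j, ∀ c, ν ⟨j, c⟩ = 0} (by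
      intro b ν hν
      rw [Set.mem_ofPred_eq]
      by_contra! hcon
      exact MvPolynomial.mem_support_iff.1 hν
        (coeff_sub_foldr_polyDiff_eq_zero c P hP hPc (fun i s => b (i, s)) ν hcon))
  refine ⟨P, Q, ?_, ?_, ?_, ?_⟩
  · refine Finset.sup_le fun ν hν => ?_
    obtain ⟨e, v, rfl⟩ := hP ν hν
    have h := degree_fullExp e v
    rw [Fintype.card_fin] at h
    exact (h.trans (by omega)).le
  · intro ν hν j
    obtain ⟨e, v, rfl⟩ := hP ν hν
    exact ⟨v j, by simp [fullExp, transExp_apply]⟩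
  · intro M hM
    obtain ⟨ν, ⟨j, hj⟩, hMν⟩ := hQ M hM
    exact ⟨j, fun c => (hMν _).trans (hj c)⟩
  · intro a x
    let φ : (∀ j : Fin k, Fin (n j) → ZMod p) →+ (Σ j : Fin k, Fin (n j)) → ZMod p :=
      { toFun := fun y s => y s.1 s.2
        map_zero' := rfl
        map_add' := fun _ _ => rfl }
    have hder := aderivList_eval_comp φ P (List.ofFn a) x
    rw [List.map_ofFn] at hder
    have hmon : ∀ v : ∀ j : Fin k, Fin (n j), ∀ t : ZMod p,
        MvPolynomial.eval (φ x) (MvPolynomial.monomial (transExp v) t) =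
          (∏ j, x j (v j)) * t := by
      intro v t
      rw [MvPolynomial.eval_monomial, mul_comm, transExp,
        ← Finsupp.prod_finsetSum_index (by simp) (by intros; rw [pow_add])]
      simp [φ]
    refine Eq.trans ?_ (congrArg₂ (· + ·) hder.symm
      (hQe (fun w => a w.1 w.2.1 w.2.2) (φ x)).symm)
    rw [map_sub, map_sum]
    simp only [hmon]
    rw [hψ.expand a x]
    exact (add_sub_cancel _ _).symm

end DGU
end
end

section
/- There exist absolute constants C, D ≥ 1 such that the following holds. Let p be a prime, G_1, …, G_k finite-dimensional F_p-vector spaces, f : G_1 × ⋯ × G_k → 𝔻 a function, and let α, α' : G_1 × ⋯ × G_k → F_p be multilinear forms with bias(α − α') ≥ c for some c > 0. If α ∈ MLS_ε(f) for some ε > 0, then α' ∈ MLS_{ε'}(f), where ε' = ε · p^{−C·(log_p c^{−1})^D}. -/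
noncomputable section

namespace DGU

lemma conjIter_succ (n : ℕ) (z : ℂ) : conjIter (n + 1) z = starRingEnd ℂ (conjIter n z) :=
  Function.iterate_succ_apply' _ _ _

lemma conjIter_mul (n : ℕ) (z w : ℂ) : conjIter n (z * w) = conjIter n z * conjIter n w := by
  induction n with
  | zero => rfl
  | succ n ih => rw [conjIter_succ, ih, map_mul, ← conjIter_succ, ← conjIter_succ]

lemma norm_conjIter (n : ℕ) (z : ℂ) : ‖conjIter n z‖ = ‖z‖ := by
  induction n with
  | zero => rfl
  | succ n ih => rw [conjIter_succ, RCLike.norm_conj, ih]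

section BoxForm

variable {k : ℕ} {G : Fin k → Type*}

lemma sum_sum_update_s9 {ι : Type*} [Fintype ι] [DecidableEq ι] {X : ι → Type*}
    [∀ i, Fintype (X i)] {M : Type*} [AddCommMonoid M] (i : ι) (φ : (∀ j, X j) → M) :
    ∑ x, ∑ t, φ (Function.update x i t) = Fintype.card (X i) • ∑ x, φ x := by
  have h : ∑ q : (∀ j, X j) × X i, φ (Function.update q.1 i q.2)
      = ∑ q : (∀ j, X j) × X i, φ q.1 := by
    refine Fintype.sum_equiv
      (Function.Involutive.toPerm (fun q : (∀ j, X j) × X i => (Function.update q.1 i q.2, q.1 i))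
        (fun q => by simp)) _ _ (fun q => rfl)
  rw [← Fintype.sum_prod_type' (fun x t => φ (Function.update x i t)), h,
    Fintype.sum_prod_type, Finset.smul_sum]
  simp

/-- The factors of the Gowers inner product which do not involve the `i`-th coordinate of the
first point. -/
def face (i : Fin k) (F : Finset (Fin k) → (∀ i, G i) → ℂ) (x y : ∀ i, G i) : ℂ :=
  ∏ I ∈ (Finset.univ.erase i).powerset, conjIter I.card (F I (I.piecewise x y))

lemma face_update (i : Fin k) (F : Finset (Fin k) → (∀ i, G i) → ℂ) (x y : ∀ i, G i) (t : G i) :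
    face i F (Function.update x i t) y = face i F x y := by
  refine Finset.prod_congr rfl fun I hI => ?_
  have hi : i ∉ I := fun h => by simpa using Finset.mem_powerset.1 hI h
  congr 2
  ext j
  by_cases hj : j ∈ I
  · have : j ≠ i := fun h => hi (h ▸ hj)
    simp [hj, this]
  · simp [hj]

lemma prod_eq_face_mul (i : Fin k) (F : Finset (Fin k) → (∀ i, G i) → ℂ) (x y : ∀ i, G i) :
    ∏ I : Finset (Fin k), conjIter I.card (F I (I.piecewise x y)) =
      face i F x y *
        starRingEnd ℂ (face i (fun I => F (insert i I)) x (Function.update y i (x i))) := by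
  have h : (Finset.univ : Finset (Finset (Fin k)))
      = (insert i (Finset.univ.erase i)).powerset := by
    rw [Finset.insert_erase (Finset.mem_univ i), Finset.powerset_univ]
  rw [h, Finset.prod_powerset_insert (Finset.notMem_erase i _), face, face, map_prod]
  congr 1
  refine Finset.prod_congr rfl fun I hI => ?_
  have hi : i ∉ I := fun h => by simpa using Finset.mem_powerset.1 hI h
  rw [Finset.card_insert_of_notMem hi, conjIter_succ]
  congr 3
  ext j
  by_cases hj : j = i
  · subst hj
    simp [hi]
  · by_cases hI : j ∈ I <;> simp [hj, hI]

variable [∀ i, Fintype (G i)]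

/-- The unnormalised Gowers inner product of a family indexed by subsets of `[k]`. -/
def boxForm (F : Finset (Fin k) → (∀ i, G i) → ℂ) : ℂ :=
  ∑ x, ∑ y, ∏ I : Finset (Fin k), conjIter I.card (F I (I.piecewise x y))

/-- `face` summed over the `i`-th coordinate of the second point. -/
def faceSum (i : Fin k) (F : Finset (Fin k) → (∀ i, G i) → ℂ) (x y : ∀ i, G i) : ℂ :=
  ∑ s, face i F x (Function.update y i s)

lemma card_sq_mul_boxForm (i : Fin k) (F : Finset (Fin k) → (∀ i, G i) → ℂ) :
    (Fintype.card (G i) : ℂ) ^ 2 * boxForm F =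
      ∑ x, ∑ y, faceSum i F x y * starRingEnd ℂ (faceSum i (fun I => F (insert i I)) x y) := by
  have h1 : (Fintype.card (G i) : ℂ) * boxForm F = ∑ x, ∑ t, ∑ y, face i F x y *
      starRingEnd ℂ (face i (fun I => F (insert i I)) x (Function.update y i t)) := by
    rw [← nsmul_eq_mul, boxForm, ← sum_sum_update_s9]
    refine Finset.sum_congr rfl fun x _ => Finset.sum_congr rfl fun t _ =>
      Finset.sum_congr rfl fun y _ => ?_
    rw [prod_eq_face_mul i, face_update, face_update, Function.update_self]
  rw [sq, mul_assoc, h1, Finset.mul_sum]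
  refine Finset.sum_congr rfl fun x _ => ?_
  rw [Finset.sum_comm, ← nsmul_eq_mul, ← sum_sum_update_s9]
  refine Finset.sum_congr rfl fun y _ => ?_
  simp only [faceSum, map_sum, Finset.sum_mul_sum, Function.update_idem]

lemma card_sq_mul_boxForm_of_insert (i : Fin k) (F H : Finset (Fin k) → (∀ i, G i) → ℂ)
    (h0 : ∀ I, i ∉ I → H I = F I) (h1 : ∀ I, i ∉ I → H (insert i I) = F I) :
    (Fintype.card (G i) : ℂ) ^ 2 * boxForm H =
      ((∑ q : (∀ i, G i) × (∀ i, G i), ‖faceSum i F q.1 q.2‖ ^ 2 : ℝ) : ℂ) := by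
  have key : ∀ K : Finset (Fin k) → (∀ i, G i) → ℂ, (∀ I, i ∉ I → K I = F I) →
      ∀ x y, faceSum i K x y = faceSum i F x y := by
    intro K hK x y
    refine Finset.sum_congr rfl fun s _ => Finset.prod_congr rfl fun I hI => ?_
    rw [hK I fun h => by simpa using Finset.mem_powerset.1 hI h]
  rw [card_sq_mul_boxForm, Fintype.sum_prod_type]
  push_cast
  refine Finset.sum_congr rfl fun x _ => Finset.sum_congr rfl fun y _ => ?_
  rw [key H h0, key _ h1, Complex.mul_conj, Complex.normSq_eq_norm_sq]
  push_cast
  rfl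

lemma boxForm_const_eq_ofReal [∀ i, Nonempty (G i)] (i : Fin k) (g : (∀ i, G i) → ℂ) :
    (boxForm fun _ => g) = (((∑ q : (∀ i, G i) × (∀ i, G i),
      ‖faceSum i (fun _ => g) q.1 q.2‖ ^ 2) / (Fintype.card (G i) : ℝ) ^ 2 : ℝ) : ℂ) := by
  have h := card_sq_mul_boxForm_of_insert i (fun _ => g) (fun _ => g)
    (fun _ _ => rfl) (fun _ _ => rfl)
  have hc : (Fintype.card (G i) : ℂ) ≠ 0 := Nat.cast_ne_zero.2 Fintype.card_ne_zero
  push_cast at h ⊢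
  rw [← h]
  field_simp

/-- One Cauchy–Schwarz step of the Gowers–Cauchy–Schwarz inequality. -/
lemma norm_boxForm_sq_le [∀ i, Nonempty (G i)] (i : Fin k)
    (F : Finset (Fin k) → (∀ i, G i) → ℂ) :
    ‖boxForm F‖ ^ 2 ≤
      ‖boxForm fun I => F (I.erase i)‖ * ‖boxForm fun I => F (insert i I)‖ := by
  have e0 := card_sq_mul_boxForm_of_insert i F (fun I => F (I.erase i))
    (fun I hI => by simp [hI]) (fun I hI => by simp [hI])
  have e1 := card_sq_mul_boxForm_of_insert i (fun I => F (insert i I)) (fun I => F (insert i I))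
    (fun I hI => rfl) (fun I hI => by simp)
  have e := card_sq_mul_boxForm i F
  set a := fun q : (∀ i, G i) × (∀ i, G i) => ‖faceSum i F q.1 q.2‖
  set b := fun q : (∀ i, G i) × (∀ i, G i) => ‖faceSum i (fun I => F (insert i I)) q.1 q.2‖
  have hc : (0 : ℝ) < (Fintype.card (G i) : ℝ) ^ 2 := by
    have : 0 < Fintype.card (G i) := Fintype.card_pos
    positivity
  have n0 := congrArg norm e0
  have n1 := congrArg norm e1
  have n := congrArg norm e
  rw [norm_mul, norm_pow, Complex.norm_natCast] at n0 n1 n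
  rw [Complex.norm_real, Real.norm_of_nonneg (by positivity)] at n0 n1
  have hle : (Fintype.card (G i) : ℝ) ^ 2 * ‖boxForm F‖ ≤ ∑ q, a q * b q := by
    rw [n, ← Fintype.sum_prod_type' (fun x y => faceSum i F x y *
      starRingEnd ℂ (faceSum i (fun I => F (insert i I)) x y))]
    refine (norm_sum_le _ _).trans (Finset.sum_le_sum fun q _ => ?_)
    rw [norm_mul, RCLike.norm_conj]
  have hcs := Finset.sum_mul_sq_le_sq_mul_sq Finset.univ a b
  have hsq := (pow_le_pow_left₀ (by positivity) hle 2).trans hcs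
  rw [← n0, ← n1] at hsq
  refine le_of_mul_le_mul_left ?_ (mul_pos hc hc)
  linarith

lemma boxForm_const_mul_le [∀ i, Nonempty (G i)] (i : Fin k) (g u : (∀ i, G i) → ℂ)
    (hu : ∀ x, ‖u x‖ ≤ 1) (hi : ∀ x t, u (Function.update x i t) = u x) :
    (boxForm fun _ => g * u).re ≤ (boxForm fun _ => g).re := by
  rw [boxForm_const_eq_ofReal i, boxForm_const_eq_ofReal i, Complex.ofReal_re, Complex.ofReal_re]
  gcongr with q
  obtain ⟨x, y⟩ := q
  have hf : ∀ s, face i (fun _ => u) x (Function.update y i s) = face i (fun _ => u) x y := by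
    intro s
    refine Finset.prod_congr rfl fun I hI => ?_
    have hiI : i ∉ I := fun h => by simpa using Finset.mem_powerset.1 hI h
    rw [← Finset.update_piecewise_of_notMem _ _ _ hiI]
    exact congrArg _ (hi _ s)
  have h : faceSum i (fun _ => g * u) x y =
      faceSum i (fun _ => g) x y * face i (fun _ => u) x y := by
    rw [faceSum, faceSum, Finset.sum_mul]
    refine Finset.sum_congr rfl fun s _ => ?_
    rw [← hf s, face, face, face, ← Finset.prod_mul_distrib]
    simp only [Pi.mul_apply, conjIter_mul]
  have hn : ‖face i (fun _ => u) x y‖ ≤ 1 := by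
    rw [face, norm_prod]
    exact Finset.prod_le_one (fun _ _ => norm_nonneg _) fun I _ => by
      rw [norm_conjIter]; exact hu _
  simp only [h, norm_mul]
  exact mul_le_of_le_one_right (norm_nonneg _) hn

lemma boxForm_const_mul_prod_le [∀ i, Nonempty (G i)] {σ : Type*} (S : Finset σ)
    (g : (∀ i, G i) → ℂ) (u : σ → (∀ i, G i) → ℂ) (hu : ∀ s ∈ S, ∀ x, ‖u s x‖ ≤ 1)
    (hi : ∀ s ∈ S, ∃ i, ∀ x t, u s (Function.update x i t) = u s x) :
    (boxForm fun _ => g * ∏ s ∈ S, u s).re ≤ (boxForm fun _ => g).re := by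
  classical
  induction S using Finset.induction_on with
  | empty => simp
  | insert s S hs ih =>
    obtain ⟨i, hi'⟩ := hi s (Finset.mem_insert_self _ _)
    rw [Finset.prod_insert hs, mul_comm (u s), ← mul_assoc]
    exact (boxForm_const_mul_le i _ _ (hu s (Finset.mem_insert_self _ _)) hi').trans
      (ih (fun t ht => hu t (Finset.mem_insert_of_mem ht))
        fun t ht => hi t (Finset.mem_insert_of_mem ht))

/-- The Gowers–Cauchy–Schwarz inequality for a family with only two distinct members. -/
lemma norm_boxForm_ite_pow_le [∀ i, Nonempty (G i)] (g h : (∀ i, G i) → ℂ) (S : Finset (Fin k)) :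
    ‖boxForm fun I => if I = ∅ then h else g‖ ^ 2 ^ S.card ≤
      ‖boxForm fun I => if I ⊆ S then h else g‖ * ‖boxForm fun _ => g‖ ^ (2 ^ S.card - 1) := by
  induction S using Finset.induction_on with
  | empty => simp
  | insert i S hi ih =>
    have step := norm_boxForm_sq_le i (fun I => if I ⊆ S then h else g)
    have h0 : (fun I : Finset (Fin k) => if I.erase i ⊆ S then h else g)
        = fun I => if I ⊆ insert i S then h else g := by
      funext I
      simp only [Finset.subset_insert_iff]
    have h1 : (fun I : Finset (Fin k) => if insert i I ⊆ S then h else g) = fun _ => g := by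
      funext I
      exact if_neg fun hI => hi (hI (Finset.mem_insert_self _ _))
    rw [h0, h1] at step
    have hp : 2 ^ (insert i S).card - 1 = 1 + (2 ^ S.card - 1) * 2 := by
      have := Nat.one_le_two_pow (n := S.card)
      rw [Finset.card_insert_of_notMem hi, pow_succ]
      omega
    rw [hp, Finset.card_insert_of_notMem hi, pow_succ, pow_mul, pow_add, pow_one, pow_mul,
      ← mul_assoc]
    calc _ ≤ _ := pow_le_pow_left₀ (by positivity) ih 2
      _ ≤ _ := by
        rw [mul_pow]
        gcongr

lemma boxForm_ite_empty (g h : (∀ i, G i) → ℂ) :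
    (boxForm fun I => if I = ∅ then h else g) = ∑ x, ∑ y, h y *
      ∏ I ∈ Finset.univ.erase (∅ : Finset (Fin k)), conjIter I.card (g (I.piecewise x y)) := by
  refine Finset.sum_congr rfl fun x _ => Finset.sum_congr rfl fun y _ => ?_
  rw [← Finset.mul_prod_erase _ _ (Finset.mem_univ ∅)]
  refine congrArg₂ (· * ·) (by simp [conjIter]) ?_
  exact Finset.prod_congr rfl fun I hI => by simp only [if_neg (Finset.ne_of_mem_erase hI)]

lemma boxPow_eq_boxForm_div (g : (∀ i, G i) → ℂ) :
    boxPow g = (boxForm fun _ => g) /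
      ((Fintype.card ((∀ i, G i) × (∀ i, G i)) : ℝ) : ℂ) := by
  rw [boxPow, cavg, Fintype.sum_prod_type]
  rfl

end BoxForm

section chi

variable {p : ℕ} [NeZero p]

lemma chi_eq_toCircle (t : ZMod p) : chi p t = ZMod.toCircle t := by
  rw [ZMod.toCircle_apply, chi, mul_div_assoc]

lemma chi_add (s t : ZMod p) : chi p (s + t) = chi p s * chi p t := by
  simp [chi_eq_toCircle, AddChar.map_add_eq_mul]

lemma chi_neg (t : ZMod p) : chi p (-t) = starRingEnd ℂ (chi p t) := by
  rw [chi_eq_toCircle, chi_eq_toCircle, AddChar.map_neg_eq_inv, Circle.coe_inv_eq_conj]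

lemma norm_chi (t : ZMod p) : ‖chi p t‖ = 1 := by
  rw [chi_eq_toCircle, Circle.norm_coe]

lemma chi_sum {σ : Type*} (S : Finset σ) (t : σ → ZMod p) :
    chi p (∑ s ∈ S, t s) = ∏ s ∈ S, chi p (t s) := by
  classical
  induction S using Finset.induction_on with
  | empty => simp [chi]
  | insert s S hs ih => rw [Finset.sum_insert hs, Finset.prod_insert hs, chi_add, ih]

end chi

section Bias

variable {p k : ℕ} {G : Fin k → Type*} [∀ i, AddCommGroup (G i)] [∀ i, Module (ZMod p) (G i)]
  [∀ i, Fintype (G i)]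

/-- The weights `x ↦ χ (γ (x + a))` differ from `x ↦ χ (γ x)` by bounded factors, each
independent of some coordinate. -/
lemma boxForm_mul_chi_shift_le [NeZero p] (γ : MultilinearMap (ZMod p) G (ZMod p))
    (g : (∀ i, G i) → ℂ) (a : ∀ i, G i) :
    (boxForm fun _ => fun x => g x * chi p (γ (x + a))).re ≤
      (boxForm fun _ => fun x => g x * chi p (γ x)).re := by
  have h : (fun x => g x * chi p (γ (x + a))) = (fun x => g x * chi p (γ x)) *
      ∏ s ∈ Finset.univ.erase (Finset.univ : Finset (Fin k)),
        fun x => chi p (γ (s.piecewise x a)) := by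
    funext x
    rw [γ.map_add_univ, chi_sum, ← Finset.mul_prod_erase _ _ (Finset.mem_univ Finset.univ),
      Finset.piecewise_univ, Pi.mul_apply, Finset.prod_apply, mul_assoc]
  rw [h]
  refine boxForm_const_mul_prod_le _ _ _ (fun s _ x => (norm_chi _).le) fun s hs => ?_
  obtain ⟨i, hi⟩ : ∃ i, i ∉ s := by
    by_contra! hs'
    exact Finset.ne_of_mem_erase hs (Finset.eq_univ_iff_forall.2 hs')
  refine ⟨i, fun x t => ?_⟩
  congr 2
  ext j
  by_cases hj : j ∈ s
  · have : j ≠ i := fun h => hi (h ▸ hj)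
    simp [hj, this]
  · simp [hj]

/-- Multiplying by the character of a biased multilinear form decreases the box norm by at most
a factor of the bias. -/
lemma pow_mul_boxForm_le [NeZero p] (hk : 0 < k) (γ : MultilinearMap (ZMod p) G (ZMod p))
    (g : (∀ i, G i) → ℂ) {c : ℝ} (hc : 0 < c)
    (hγ : c * Fintype.card (∀ i, G i) ≤ ‖∑ a, chi p (γ a)‖)
    (hpos : 0 < (boxForm fun _ => g).re) :
    c ^ 2 ^ k * (boxForm fun _ => g).re ≤ (boxForm fun _ => fun x => g x * chi p (γ x)).re := by
  have hre : ∀ f : (∀ i, G i) → ℂ, ‖boxForm fun _ => f‖ = (boxForm fun _ => f).re := by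
    intro f
    rw [boxForm_const_eq_ofReal ⟨0, hk⟩, Complex.ofReal_re, Complex.norm_real,
      Real.norm_of_nonneg (by positivity)]
  set h : (∀ i, G i) → (∀ i, G i) → ℂ := fun a x => g x * chi p (γ (x + a))
  have hsum : ∑ a, (boxForm fun I => if I = ∅ then h a else g)
      = (∑ a, chi p (γ a)) * boxForm fun _ => g := by
    have hg : (boxForm fun _ => g) = boxForm fun I => if I = ∅ then g else g := by simp
    rw [hg]
    simp only [boxForm_ite_empty]
    rw [Finset.sum_comm, Finset.mul_sum]
    refine Finset.sum_congr rfl fun x _ => ?_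
    rw [Finset.sum_comm, Finset.mul_sum]
    refine Finset.sum_congr rfl fun y _ => ?_
    have hs : ∑ a, chi p (γ a) = ∑ a, chi p (γ (y + a)) :=
      (Equiv.sum_comp (Equiv.addLeft y) fun a => chi p (γ a)).symm
    rw [← Finset.sum_mul, hs, ← Finset.mul_sum]
    ring
  obtain ⟨a, -, ha⟩ : ∃ a ∈ (Finset.univ : Finset (∀ i, G i)),
      c * ‖boxForm fun _ => g‖ ≤ ‖boxForm fun I => if I = ∅ then h a else g‖ := by
    refine Finset.exists_le_of_sum_le Finset.univ_nonempty ?_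
    calc ∑ _a : (∀ i, G i), c * ‖boxForm fun _ => g‖
        = c * Fintype.card (∀ i, G i) * ‖boxForm fun _ => g‖ := by
          rw [Finset.sum_const, Finset.card_univ, nsmul_eq_mul]
          ring
      _ ≤ ‖∑ a, chi p (γ a)‖ * ‖boxForm fun _ => g‖ := by gcongr
      _ = ‖∑ a, (boxForm fun I => if I = ∅ then h a else g)‖ := by rw [hsum, norm_mul]
      _ ≤ _ := norm_sum_le _ _
  have hcs := norm_boxForm_ite_pow_le g (h a) Finset.univ
  simp only [Finset.subset_univ, if_true, Finset.card_univ, Fintype.card_fin] at hcs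
  have hpow := (pow_le_pow_left₀ (by positivity) ha (2 ^ k)).trans hcs
  rw [hre, hre, mul_pow,
    ← mul_pow_sub_one (pow_ne_zero k two_ne_zero) (boxForm fun _ => g).re, ← mul_assoc] at hpow
  exact (le_of_mul_le_mul_right hpow (pow_pos hpos _)).trans (boxForm_mul_chi_shift_le γ g a)

end Bias

/-- Lemma 14, close forms and the large multilinear spectrum: there are
absolute constants `C, D ≥ 1` such that if `α, α'` are multilinear forms with
`bias (α - α') ≥ c` and `α` lies in the `ε`-large multilinear spectrum of `f`, then `α'`
lies in the `ε'`-large multilinear spectrum of `f`, where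
`ε' = ε · p^{-C (log_p c⁻¹)^D}`. -/
theorem close_forms_in_spectrum :
    ∃ C D : ℝ, 1 ≤ C ∧ 1 ≤ D ∧
      ∀ (p k : ℕ), p.Prime → 0 < k →
      ∀ (G : Fin k → Type) [∀ i, AddCommGroup (G i)] [∀ i, Module (ZMod p) (G i)]
        [∀ i, Fintype (G i)] (f : (∀ i, G i) → ℂ),
        (∀ x, ‖f x‖ ≤ 1) →
        ∀ (α α' : MultilinearMap (ZMod p) G (ZMod p)) (c ε : ℝ), 0 < c → 0 < ε →
          c ≤ (cavg (fun x : ∀ i, G i => chi p ((α - α') x))).re →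
          MemMLS p ε f α →
          MemMLS p (ε * (p : ℝ) ^ (-(C * Real.logb p c⁻¹ ^ D))) f α' := by
  refine ⟨1, 1, le_rfl, le_rfl, ?_⟩
  intro p k hp hk G _ _ _ f _ α α' c ε hc hε hbias hα
  have : Fact p.Prime := ⟨hp⟩
  have hscale : (p : ℝ) ^ (-(1 * Real.logb p c⁻¹ ^ (1 : ℝ))) = c := by
    rw [Real.rpow_one, one_mul, Real.logb_inv, neg_neg,
      Real.rpow_logb (by exact_mod_cast hp.pos) (by exact_mod_cast hp.ne_one) hc]
  rw [hscale]
  unfold MemMLS at hα ⊢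
  have hN : (0 : ℝ) < Fintype.card ((∀ i, G i) × (∀ i, G i)) := by
    exact_mod_cast Fintype.card_pos
  have hM : (0 : ℝ) < Fintype.card (∀ i, G i) := by exact_mod_cast Fintype.card_pos
  rw [boxPow_eq_boxForm_div, Complex.div_ofReal_re] at hα ⊢
  have hpos : 0 < (boxForm fun _ => fun x => f x * chi p (α x)).re :=
    (div_pos_iff_of_pos_right hN).1 ((pow_pos hε _).trans_le hα)
  have hγ : c * Fintype.card (∀ i, G i) ≤ ‖∑ a, chi p ((α' - α) a)‖ := by
    have hneg : ∑ a, chi p ((α' - α) a) = starRingEnd ℂ (∑ a, chi p ((α - α') a)) := by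
      rw [map_sum]
      refine Finset.sum_congr rfl fun a _ => ?_
      rw [← chi_neg, ← neg_sub α α', neg_apply]
    rw [hneg, RCLike.norm_conj, ← le_div_iff₀ hM]
    refine (hbias.trans (Complex.re_le_norm _)).trans_eq ?_
    rw [cavg, norm_div, Complex.norm_natCast]
  have key := pow_mul_boxForm_le hk (α' - α) _ hc hγ hpos
  have hmul : (fun x => f x * chi p (α x) * chi p ((α' - α) x)) = fun x => f x * chi p (α' x) := by
    funext x
    rw [mul_assoc, ← chi_add, sub_apply, add_sub_cancel]
  rw [hmul] at key
  rw [mul_comm, mul_pow]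
  refine (mul_le_mul_of_nonneg_left hα (by positivity)).trans ?_
  rw [← mul_div_assoc]
  gcongr

end DGU
end
end
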